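/- Let k = F_q with q even, n = 2m ≥ 4, V = k^n with basis e₁,…,e_{2m} and dual basis x₁,…,x_n, and equip V with the quadratic form Q = Σ_{i=1}^m x_i x_{m+i} of maximal Witt index, so that g ∈ GL_n(k) lies in GO_n^+(q) if and only if Q ∘ g = Q. Then the point stabilizer H in GO_n^+(q) of the maximal isotropic subspace U = ⟨e_{m+1},…,e_{2m}⟩ consists exactly of the block matrices [[I,O],[B,I]] with B an m×m matrix satisfying B_{ij} = B_{ji} for i ≠ j and B_{ii} = 0 for all i; moreover H is a nontrivial 2-group containing no pseudo-reflections. -/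

import Mathlib

open Matrix

/-- A pseudo-reflection: fixed-point space of codimension one. -/
def IsPseudoReflection {k : Type} [Field k] {ι : Type} [Fintype ι] [DecidableEq ι]
    (g : Matrix ι ι k) : Prop :=
  Module.finrank k (LinearMap.ker (g.mulVecLin - LinearMap.id)) + 1 = Fintype.card ι

/-- The quadratic form `Q = Σ_{i=1}^m x_i x_{m+i}` of maximal Witt index on `k^{2m}`. -/
def QPlus (m : ℕ) (k : Type) [Field k] : (Fin m ⊕ Fin m → k) → k :=
  fun v => ∑ i : Fin m, v (Sum.inl i) * v (Sum.inr i)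

/-- The point stabilizer in `GO_{2m}^+(q)`, `q` even, of `U = ⟨e_{m+1},…,e_{2m}⟩`:
the set of block matrices `[[I,O],[B,I]]` with `B_{ij} = B_{ji}` for `i ≠ j` and
`B_{ii} = 0`. -/
def alternatingBlockSet (m : ℕ) (k : Type) [Field k] :
    Set (Matrix (Fin m ⊕ Fin m) (Fin m ⊕ Fin m) k) :=
  {g | ∃ B : Matrix (Fin m) (Fin m) k,
    ((∀ i j, i ≠ j → B i j = B j i) ∧ ∀ i, B i i = 0) ∧
    g = Matrix.fromBlocks 1 0 B 1}

/-- In characteristic two, a symmetric matrix with zero diagonal has vanishing quadratic form. -/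
theorem dotProduct_mulVec_self_eq_zero {ι R : Type*} [Fintype ι] [CommRing R] [CharP R 2]
    {B : Matrix ι ι R} (hsymm : ∀ i j, i ≠ j → B i j = B j i) (hdiag : ∀ i, B i i = 0)
    (x : ι → R) : x ⬝ᵥ B *ᵥ x = 0 := by
  classical
  simp only [dotProduct, mulVec, Finset.mul_sum]
  rw [← Finset.sum_product']
  refine Finset.sum_involution (fun ij _ => ij.swap) ?_ ?_ (by simp) (by simp)
  · rintro ⟨i, j⟩ -
    rcases eq_or_ne i j with rfl | hij
    · simp [hdiag]
    · have h : x i * (B i j * x j) = x j * (B j i * x i) := by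
        rw [hsymm i j hij]; ring
      simp only [Prod.swap, h]
      exact CharTwo.add_self_eq_zero _
  · rintro ⟨i, j⟩ - hne heq
    obtain rfl : j = i := congrArg Prod.fst heq
    simp [hdiag] at hne

/-- In characteristic two, a matrix with vanishing quadratic form is symmetric
with zero diagonal. -/
theorem symm_and_diag_eq_zero_of_dotProduct_mulVec_self {ι R : Type*} [Fintype ι] [DecidableEq ι]
    [CommRing R] [CharP R 2] {B : Matrix ι ι R} (h : ∀ x : ι → R, x ⬝ᵥ B *ᵥ x = 0) :
    (∀ i j, i ≠ j → B i j = B j i) ∧ ∀ i, B i i = 0 := by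
  have hdiag : ∀ i, B i i = 0 := fun i => by simpa using h (Pi.single i 1)
  refine ⟨fun i j _ => ?_, hdiag⟩
  have hij := h (Pi.single i 1 + Pi.single j 1)
  simp only [mulVec_add, add_dotProduct, dotProduct_add, mulVec_single_one, single_dotProduct,
    one_mul, col_apply, hdiag, zero_add, add_zero] at hij
  exact (CharTwo.add_eq_zero.mp hij).symm

theorem QPlus_sumElim {m : ℕ} {k : Type} [Field k] (x y : Fin m → k) :
    QPlus m k (Sum.elim x y) = x ⬝ᵥ y := rfl

/-- A matrix fixes the span of the second half of the standard basis pointwise exactly when its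
right-hand blocks are `0` and `1`. -/
theorem fromBlocks_fixes_span_inr_iff {ι k : Type*} [Fintype ι] [DecidableEq ι] [Field k]
    (A B C D : Matrix ι ι k) :
    (∀ u ∈ Submodule.span k (Set.range fun i : ι => (Pi.single (Sum.inr i) 1 : ι ⊕ ι → k)),
      fromBlocks A B C D *ᵥ u = u) ↔ B = 0 ∧ D = 1 := by
  have hspan : (∀ u ∈ Submodule.span k
      (Set.range fun i : ι => (Pi.single (Sum.inr i) 1 : ι ⊕ ι → k)),
      fromBlocks A B C D *ᵥ u = u) ↔
      ∀ i, fromBlocks A B C D *ᵥ Pi.single (Sum.inr i) 1 = Pi.single (Sum.inr i) 1 := by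
    refine ⟨fun h i => h _ (Submodule.subset_span ⟨i, rfl⟩), fun h u hu => ?_⟩
    have hle : Submodule.span k (Set.range fun i : ι => (Pi.single (Sum.inr i) 1 : ι ⊕ ι → k)) ≤
        LinearMap.eqLocus (fromBlocks A B C D).mulVecLin LinearMap.id :=
      Submodule.span_le.mpr (by rintro _ ⟨i, rfl⟩; exact h i)
    exact hle hu
  rw [hspan]
  constructor
  · intro h
    constructor
    · ext i j
      simpa using congrFun (h j) (Sum.inl i)
    · ext i j
      simpa [one_apply, Pi.single_apply] using congrFun (h j) (Sum.inr i)
  · rintro ⟨rfl, rfl⟩ j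
    ext (i | i) <;> simp [one_apply, Pi.single_apply]

/-- A lower triangular block matrix preserves the hyperbolic form exactly when its upper block is
the identity and its lower block has vanishing quadratic form. -/
theorem QPlus_fromBlocks_mulVec_iff {m : ℕ} {k : Type} [Field k]
    (A C : Matrix (Fin m) (Fin m) k) :
    (∀ v, QPlus m k (fromBlocks A 0 C 1 *ᵥ v) = QPlus m k v) ↔
      A = 1 ∧ ∀ x : Fin m → k, x ⬝ᵥ C *ᵥ x = 0 := by
  have hQ : ∀ x y : Fin m → k, QPlus m k (fromBlocks A 0 C 1 *ᵥ Sum.elim x y) =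
      A *ᵥ x ⬝ᵥ C *ᵥ x + A *ᵥ x ⬝ᵥ y := fun x y => by
    simp [fromBlocks_mulVec, QPlus_sumElim, dotProduct_add]
  constructor
  · intro h
    have hxy : ∀ x y : Fin m → k, A *ᵥ x ⬝ᵥ C *ᵥ x + A *ᵥ x ⬝ᵥ y = x ⬝ᵥ y := fun x y => by
      rw [← hQ, h, QPlus_sumElim]
    have hC : ∀ x : Fin m → k, A *ᵥ x ⬝ᵥ C *ᵥ x = 0 := fun x => by simpa using hxy x 0
    obtain rfl : A = 1 := by
      ext i j
      have := hxy (Pi.single j 1) (Pi.single i 1)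
      rw [hC] at this
      simpa [one_apply, Pi.single_apply] using this
    exact ⟨rfl, by simpa using hC⟩
  · rintro ⟨rfl, hC⟩ v
    rw [← Sum.elim_comp_inl_inr v, hQ, QPlus_sumElim]
    simp [hC]

/-- A lower unitriangular block matrix whose lower block is symmetric with zero diagonal is not a
pseudo-reflection: its lower block cannot have rank one. -/
theorem not_isPseudoReflection_fromBlocks {m : ℕ} {k : Type} [Field k]
    {B : Matrix (Fin m) (Fin m) k} (hsymm : ∀ i j, i ≠ j → B i j = B j i)
    (hdiag : ∀ i, B i i = 0) : ¬ IsPseudoReflection (fromBlocks 1 0 B 1) := by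
  intro h
  unfold IsPseudoReflection at h
  set f := (fromBlocks 1 0 B 1).mulVecLin - LinearMap.id with hf
  have hrange : Module.finrank k (LinearMap.range f) = 1 := by
    have hrn := LinearMap.finrank_range_add_finrank_ker f
    rw [Module.finrank_fintype_fun_eq_card] at hrn
    omega
  have hcol : ∀ i j, f (Pi.single (Sum.inl j) 1) (Sum.inr i) = B i j := fun i j => by
    simp [hf]
  obtain ⟨w, hw, hspan⟩ := finrank_eq_one_iff'.mp hrange
  have hmul : ∀ j, ∃ c : k, ∀ i, c * w.1 (Sum.inr i) = B i j := fun j => by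
    obtain ⟨c, hc⟩ := hspan ⟨f (Pi.single (Sum.inl j) 1), LinearMap.mem_range_self f _⟩
    refine ⟨c, fun i => ?_⟩
    rw [← hcol i j]
    exact congrFun (congrArg Subtype.val hc) (Sum.inr i)
  have hB : B = 0 := by
    ext i j
    by_contra hne
    have hij : i ≠ j := by rintro rfl; exact hne (hdiag i)
    obtain ⟨c, hc⟩ := hmul i
    obtain ⟨d, hd⟩ := hmul j
    have hcj : c * w.1 (Sum.inr j) ≠ 0 := by rw [hc, ← hsymm i j hij]; exact hne
    have hdi : d * w.1 (Sum.inr i) ≠ 0 := by rw [hd]; exact hne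
    exact mul_ne_zero (left_ne_zero_of_mul hcj) (right_ne_zero_of_mul hdi) ((hc i).trans (hdiag i))
  have hzero : f = 0 := by
    rw [hf, hB, fromBlocks_one, mulVecLin_one, sub_self]
  rw [hzero, LinearMap.range_zero, finrank_bot] at hrange
  exact zero_ne_one hrange

/-- For `q` even, the point stabilizer `H` in `GO_n^+(q)` (quadratic form
`Q = Σ x_i x_{m+i}`) of the maximal isotropic subspace `U = ⟨e_{m+1},…,e_{2m}⟩`
consists exactly of the block matrices `[[I,O],[B,I]]` with `B_{ij} = B_{ji}`
for `i ≠ j` and `B_{ii} = 0`; moreover `H` is a nontrivial `2`-group containing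
no pseudo-reflections. -/
theorem pointStabilizer_GOplus_evenChar
    (p r : ℕ) [Fact p.Prime] (hr : 0 < r) (q : ℕ) (hq : q = p ^ r) (heven : Even q)
    (m : ℕ) (hm : 2 ≤ m)
    (k : Type) [Field k] [Fintype k] (hk : Fintype.card k = q) :
    {g : Matrix (Fin m ⊕ Fin m) (Fin m ⊕ Fin m) k |
        IsUnit g ∧
        (∀ v, QPlus m k (g *ᵥ v) = QPlus m k v) ∧
        ∀ u ∈ Submodule.span k
            (Set.range fun i : Fin m =>
              (Pi.single (Sum.inr i) 1 : Fin m ⊕ Fin m → k)),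
          g *ᵥ u = u} = alternatingBlockSet m k ∧
    (∃ g ∈ alternatingBlockSet m k, g ≠ 1) ∧
    (∀ g ∈ alternatingBlockSet m k, ∃ l : ℕ, g ^ (2 ^ l) = 1) ∧
    (∀ g ∈ alternatingBlockSet m k, ¬ IsPseudoReflection g) := by
  have hp : p = 2 := by
    rw [hq, Nat.even_pow] at heven
    exact (Fact.out : p.Prime).even_iff.mp heven.1
  subst hp
  have : CharP k 2 := charP_of_card_eq_prime_pow (by rw [hk, hq])
  refine ⟨?_, ?_, ?_, ?_⟩
  · ext g
    constructor
    · rintro ⟨-, hQ, hfix⟩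
      rw [← fromBlocks_toBlocks g] at hQ hfix ⊢
      obtain ⟨hB, hD⟩ := (fromBlocks_fixes_span_inr_iff _ _ _ _).mp hfix
      rw [hB, hD] at hQ ⊢
      obtain ⟨hA, hC⟩ := (QPlus_fromBlocks_mulVec_iff _ _).mp hQ
      exact ⟨_, symm_and_diag_eq_zero_of_dotProduct_mulVec_self hC, by rw [hA]⟩
    · rintro ⟨B, ⟨hsymm, hdiag⟩, rfl⟩
      exact ⟨by simp [isUnit_iff_isUnit_det],
        (QPlus_fromBlocks_mulVec_iff _ _).mpr
          ⟨rfl, dotProduct_mulVec_self_eq_zero hsymm hdiag⟩,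
        (fromBlocks_fixes_span_inr_iff _ _ _ _).mpr ⟨rfl, rfl⟩⟩
  · refine ⟨fromBlocks 1 0 (Matrix.of fun i j => if i = j then 0 else 1) 1,
      ⟨_, ⟨fun i j hij => by simp [hij, hij.symm], fun i => by simp⟩, rfl⟩, fun h => ?_⟩
    have hentry := congrFun (congrFun h (Sum.inr ⟨0, by omega⟩)) (Sum.inl ⟨1, by omega⟩)
    simp at hentry
  · rintro _ ⟨B, -, rfl⟩
    refine ⟨1, ?_⟩
    have hBB : B + B = 0 := by
      ext i j
      exact CharTwo.add_self_eq_zero _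
    simp [pow_two, fromBlocks_multiply, hBB]
  · rintro _ ⟨B, ⟨hsymm, hdiag⟩, rfl⟩
    exact not_isPseudoReflection_fromBlocks hsymm hdiag
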